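/- arXiv:2401.06725 — 3 statements merged into one kernel-verified Lean document; each statement's English description precedes it below -/
import Mathlib

section
/- There is a universal constant C₀ > 0 such that the following holds. Let δ > 0 and let A, B, C, D, E be points on the unit circle in ℝ² such that each of the six distances ‖A − B‖, ‖B − C‖, ‖A − C‖, ‖A − D‖, ‖D − E‖, ‖A − E‖ lies in the interval [√3 − δ, √3 + δ]. Then either (‖B − D‖ ≤ C₀·δ and ‖C − E‖ ≤ C₀·δ) or (‖B − E‖ ≤ C₀·δ and ‖C − D‖ ≤ C₀·δ); that is, the points {B, C} are each within distance C₀·δ of different points of {D, E}. -/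
lemma aux_norm_sq (P Q : EuclideanSpace ℝ (Fin 2)) :
    ‖P - Q‖ ^ 2 = (P 0 - Q 0) ^ 2 + (P 1 - Q 1) ^ 2 := by
  simp [EuclideanSpace.norm_sq_eq, Fin.sum_univ_two]

lemma aux_unit (P : EuclideanSpace ℝ (Fin 2)) (h : ‖P‖ = 1) :
    P 0 ^ 2 + P 1 ^ 2 = 1 := by
  have := EuclideanSpace.norm_sq_eq P
  rw [h] at this
  simp [Fin.sum_univ_two] at this
  linarith

/-- The inner product of two unit vectors at distance about `√3` is about `-1/2`. -/
lemma aux_inner (δ : ℝ) (h0 : 0 < δ) (h1 : δ < 1 / 100) (P Q : EuclideanSpace ℝ (Fin 2))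
    (hP : ‖P‖ = 1) (hQ : ‖Q‖ = 1)
    (h : ‖P - Q‖ ∈ Set.Icc (Real.sqrt 3 - δ) (Real.sqrt 3 + δ)) :
    -(1 / 2) - 2 * δ ≤ P 0 * Q 0 + P 1 * Q 1 ∧ P 0 * Q 0 + P 1 * Q 1 ≤ -(1 / 2) + 2 * δ := by
  obtain ⟨ha, hb⟩ := h
  have e := aux_norm_sq P Q
  have uP := aux_unit P hP
  have uQ := aux_unit Q hQ
  have s3 : Real.sqrt 3 ^ 2 = 3 := Real.sq_sqrt (by norm_num)
  have s0 := Real.sqrt_nonneg 3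
  have s1 : Real.sqrt 3 ≤ 1.8 := by nlinarith
  have s2 : 1.7 ≤ Real.sqrt 3 := by nlinarith
  have k1 : ‖P - Q‖ ^ 2 ≤ (Real.sqrt 3 + δ) ^ 2 := by gcongr
  have k2 : (Real.sqrt 3 - δ) ^ 2 ≤ ‖P - Q‖ ^ 2 := by
    have : 0 ≤ Real.sqrt 3 - δ := by linarith
    gcongr
  have e' : ‖P - Q‖ ^ 2 = 2 - 2 * (P 0 * Q 0 + P 1 * Q 1) := by linear_combination e + uP + uQ
  have m1 : Real.sqrt 3 * δ ≤ 1.8 * δ := by gcongr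
  have m2 : δ * δ ≤ 1 / 100 * δ := by gcongr
  rw [e'] at k1 k2
  generalize P 0 * Q 0 + P 1 * Q 1 = x at k1 k2 ⊢
  have x1 : (Real.sqrt 3 + δ) ^ 2 = 3 + 2 * (Real.sqrt 3 * δ) + δ * δ := by
    linear_combination s3
  have x2 : (Real.sqrt 3 - δ) ^ 2 = 3 - 2 * (Real.sqrt 3 * δ) + δ * δ := by
    linear_combination s3
  have m3 : 0 ≤ δ * δ := by positivity
  constructor <;> linarith

lemma aux_q (δ p q : ℝ) (h0 : 0 < δ) (h1 : δ < 1 / 100) (u : p ^ 2 + q ^ 2 = 1)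
    (hp : -(1 / 2) - 2 * δ ≤ p ∧ p ≤ -(1 / 2) + 2 * δ) :
    3 / 4 - 4 * δ ≤ q ^ 2 ∧ q ^ 2 ≤ 3 / 4 + 4 * δ := by
  obtain ⟨a, b⟩ := hp
  constructor <;> nlinarith

lemma aux_close (δ p q r s : ℝ) (h0 : 0 < δ) (h1 : δ < 1 / 100)
    (u : p ^ 2 + q ^ 2 = 1) (v : r ^ 2 + s ^ 2 = 1)
    (hp : -(1 / 2) - 2 * δ ≤ p ∧ p ≤ -(1 / 2) + 2 * δ)
    (hr : -(1 / 2) - 2 * δ ≤ r ∧ r ≤ -(1 / 2) + 2 * δ) (hqs : 0 < q * s) :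
    (p - r) ^ 2 + (q - s) ^ 2 ≤ (10 * δ) ^ 2 := by
  obtain ⟨a, b⟩ := aux_q δ p q h0 h1 u hp
  obtain ⟨c, d⟩ := aux_q δ r s h0 h1 v hr
  have e1 : (p - r) ^ 2 ≤ (4 * δ) ^ 2 := by
    apply sq_le_sq' <;> linarith [hp.1, hp.2, hr.1, hr.2]
  have e2 : (q ^ 2 - s ^ 2) ^ 2 ≤ (8 * δ) ^ 2 := by
    apply sq_le_sq' <;> linarith
  have e3 : 1 ≤ (q + s) ^ 2 := by nlinarith
  have e4 : (q ^ 2 - s ^ 2) ^ 2 = (q - s) ^ 2 * (q + s) ^ 2 := by ring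
  nlinarith [mul_le_mul_of_nonneg_left e3 (sq_nonneg (q - s)), sq_nonneg δ]

/-- Coordinates of `P` in the orthonormal frame given by `A` are unit. -/
lemma aux_frame (A P : EuclideanSpace ℝ (Fin 2)) (hA : ‖A‖ = 1) (hP : ‖P‖ = 1) :
    (A 0 * P 0 + A 1 * P 1) ^ 2 + (A 0 * P 1 - A 1 * P 0) ^ 2 = 1 := by
  have e : (A 0 * P 0 + A 1 * P 1) ^ 2 + (A 0 * P 1 - A 1 * P 0) ^ 2
      = (A 0 ^ 2 + A 1 ^ 2) * (P 0 ^ 2 + P 1 ^ 2) := by ring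
  rw [e, aux_unit A hA, aux_unit P hP, one_mul]

lemma aux_pair (δ : ℝ) (h0 : 0 < δ) (h1 : δ < 1 / 100) (A P Q : EuclideanSpace ℝ (Fin 2))
    (hA : ‖A‖ = 1) (hP : ‖P‖ = 1) (hQ : ‖Q‖ = 1)
    (hAP : ‖A - P‖ ∈ Set.Icc (Real.sqrt 3 - δ) (Real.sqrt 3 + δ))
    (hAQ : ‖A - Q‖ ∈ Set.Icc (Real.sqrt 3 - δ) (Real.sqrt 3 + δ))
    (hs : 0 < (A 0 * P 1 - A 1 * P 0) * (A 0 * Q 1 - A 1 * Q 0)) :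
    ‖P - Q‖ ≤ 1000 * δ := by
  have k := aux_close δ _ _ _ _ h0 h1 (aux_frame A P hA hP) (aux_frame A Q hA hQ)
    (aux_inner δ h0 h1 A P hA hP hAP) (aux_inner δ h0 h1 A Q hA hQ hAQ) hs
  have e : (A 0 * P 0 + A 1 * P 1 - (A 0 * Q 0 + A 1 * Q 1)) ^ 2
      + (A 0 * P 1 - A 1 * P 0 - (A 0 * Q 1 - A 1 * Q 0)) ^ 2
      = (A 0 ^ 2 + A 1 ^ 2) * ((P 0 - Q 0) ^ 2 + (P 1 - Q 1) ^ 2) := by ring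
  rw [e, aux_unit A hA, one_mul, ← aux_norm_sq] at k
  have := abs_le_of_sq_le_sq k (by positivity)
  linarith [le_abs_self ‖P - Q‖]

lemma aux_opp (δ : ℝ) (h0 : 0 < δ) (h1 : δ < 1 / 100) (A P Q : EuclideanSpace ℝ (Fin 2))
    (hA : ‖A‖ = 1) (hP : ‖P‖ = 1) (hQ : ‖Q‖ = 1)
    (hAP : ‖A - P‖ ∈ Set.Icc (Real.sqrt 3 - δ) (Real.sqrt 3 + δ))
    (hPQ : ‖P - Q‖ ∈ Set.Icc (Real.sqrt 3 - δ) (Real.sqrt 3 + δ))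
    (hAQ : ‖A - Q‖ ∈ Set.Icc (Real.sqrt 3 - δ) (Real.sqrt 3 + δ)) :
    (A 0 * P 1 - A 1 * P 0) * (A 0 * Q 1 - A 1 * Q 0) < 0 := by
  have k1 := aux_inner δ h0 h1 A P hA hP hAP
  have k2 := aux_inner δ h0 h1 A Q hA hQ hAQ
  have k3 := aux_inner δ h0 h1 P Q hP hQ hPQ
  have e : (A 0 * P 0 + A 1 * P 1) * (A 0 * Q 0 + A 1 * Q 1)
      + (A 0 * P 1 - A 1 * P 0) * (A 0 * Q 1 - A 1 * Q 0)
      = (A 0 ^ 2 + A 1 ^ 2) * (P 0 * Q 0 + P 1 * Q 1) := by ring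
  rw [aux_unit A hA, one_mul] at e
  have : 0 ≤ (A 0 * P 0 + A 1 * P 1) * (A 0 * Q 0 + A 1 * Q 1) :=
    mul_nonneg_of_nonpos_of_nonpos (by linarith [k1.2]) (by linarith [k2.2])
  linarith [k3.2]

lemma aux_sign (x y z : ℝ) (h : x * y < 0) (h' : y * z < 0) : 0 < x * z := by
  rcases lt_trichotomy y 0 with hy | hy | hy
  · exact mul_pos (by nlinarith) (by nlinarith)
  · simp [hy] at h
  · exact mul_pos_of_neg_of_neg (by nlinarith) (by nlinarith)

/-- Lemma: two triangles inscribed in the unit circle sharing a vertex, all of whose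
side lengths are within `δ` of `√3`, have their remaining vertices pairwise within
`O(δ)` of each other (matched up in one of the two possible ways). -/
theorem stmt2 :
    ∃ C₀ : ℝ, C₀ > 0 ∧
      ∀ (δ : ℝ), 0 < δ →
        ∀ A B C D E : EuclideanSpace ℝ (Fin 2),
          ‖A‖ = 1 → ‖B‖ = 1 → ‖C‖ = 1 → ‖D‖ = 1 → ‖E‖ = 1 →
          ‖A - B‖ ∈ Set.Icc (Real.sqrt 3 - δ) (Real.sqrt 3 + δ) →
          ‖B - C‖ ∈ Set.Icc (Real.sqrt 3 - δ) (Real.sqrt 3 + δ) →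
          ‖A - C‖ ∈ Set.Icc (Real.sqrt 3 - δ) (Real.sqrt 3 + δ) →
          ‖A - D‖ ∈ Set.Icc (Real.sqrt 3 - δ) (Real.sqrt 3 + δ) →
          ‖D - E‖ ∈ Set.Icc (Real.sqrt 3 - δ) (Real.sqrt 3 + δ) →
          ‖A - E‖ ∈ Set.Icc (Real.sqrt 3 - δ) (Real.sqrt 3 + δ) →
          ((‖B - D‖ ≤ C₀ * δ ∧ ‖C - E‖ ≤ C₀ * δ) ∨
           (‖B - E‖ ≤ C₀ * δ ∧ ‖C - D‖ ≤ C₀ * δ)) := by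
  refine ⟨1000, by norm_num, ?_⟩
  intro δ h0 A B C D E hA hB hC hD hE hAB hBC hAC hAD hDE hAE
  by_cases h1 : δ < 1 / 100
  · have o1 := aux_opp δ h0 h1 A B C hA hB hC hAB hBC hAC
    have o2 := aux_opp δ h0 h1 A D E hA hD hE hAD hDE hAE
    rcases lt_trichotomy ((A 0 * B 1 - A 1 * B 0) * (A 0 * D 1 - A 1 * D 0)) 0 with h | h | h
    · right
      refine ⟨aux_pair δ h0 h1 A B E hA hB hE hAB hAE (aux_sign _ _ _ h o2),
        aux_pair δ h0 h1 A C D hA hC hD hAC hAD (aux_sign _ _ _ (by rwa [mul_comm] at o1) h)⟩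
    · exfalso
      rcases mul_eq_zero.mp h with h | h
      · simp [h] at o1
      · simp [h] at o2
    · left
      refine ⟨aux_pair δ h0 h1 A B D hA hB hD hAB hAD h,
        aux_pair δ h0 h1 A C E hA hC hE hAC hAE ?_⟩
      have o3 : (A 0 * C 1 - A 1 * C 0) * (A 0 * D 1 - A 1 * D 0) < 0 := by
        by_contra hn
        push Not at hn
        nlinarith [mul_neg_of_neg_of_pos o1 h, mul_nonneg hn (sq_nonneg (A 0 * B 1 - A 1 * B 0))]
      exact aux_sign _ _ _ o3 o2
  · left
    have h2 : (10 : ℝ) ≤ 1000 * δ := by linarith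
    have k1 := norm_sub_le B D
    have k2 := norm_sub_le C E
    rw [hB, hD] at k1
    rw [hC, hE] at k2
    constructor <;> linarith
end

section
/- There is a constant c > 0 such that the following holds. Let G = (V, E) be a finite simple graph with m ≥ 1 edges, and construct the graph H as follows: starting from G, for each edge ij ∈ E add two new vertices k_{ij} and t_{ij} and add edges so that {i, j, k_{ij}, t_{ij}} forms a 4-clique; then add a single new sink vertex t and an edge t·t_{ij} for every ij ∈ E. If WLMC_I(H) ≥ 2√6·m + m − c/m², where I is the 3×3 identity matrix, then G is 3-colorable. -/
open scoped Classical

/-- The Euclidean norm on `Fin 3 → ℝ`. -/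
noncomputable def norm3 (v : Fin 3 → ℝ) : ℝ := Real.sqrt (∑ i, v i ^ 2)

/-- The `W`-stretched linear max-cut value of a finite simple graph:
`(1/2) maxₓ ∑_{uv ∈ E} ‖W x(u) - W x(v)‖` over assignments of unit vectors in `ℝ³` to
the vertices (each unordered edge is counted twice in the double sum, whence the `1/4`). -/
noncomputable def wlmc {V : Type} [Fintype V] (W : Matrix (Fin 3) (Fin 3) ℝ)
    (G : SimpleGraph V) : ℝ :=
  sSup {c : ℝ | ∃ x : V → Fin 3 → ℝ, (∀ u, norm3 (x u) = 1) ∧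
    c = (1 / 4) * ∑ u, ∑ v,
      if G.Adj u v then norm3 (W.mulVec (x u) - W.mulVec (x v)) else 0}

/-- The graph `H` of the all-weights-equal reduction: starting from `G`, each edge
`ij ∈ E` gets two new vertices `k_{ij}`, `t_{ij}` forming a 4-clique `{i,j,k_{ij},t_{ij}}`,
and a single sink vertex `t` is joined to every `t_{ij}`. -/
def cliqueSinkGadget {V : Type} (G : SimpleGraph V) :
    SimpleGraph ((V ⊕ (G.edgeSet ⊕ G.edgeSet)) ⊕ Unit) :=
  SimpleGraph.fromRel fun a b =>
    match a, b with
    | Sum.inl (Sum.inl u), Sum.inl (Sum.inl v) => G.Adj u v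
    | Sum.inl (Sum.inl u), Sum.inl (Sum.inr (Sum.inl e)) => u ∈ (e : Sym2 V)
    | Sum.inl (Sum.inl u), Sum.inl (Sum.inr (Sum.inr e)) => u ∈ (e : Sym2 V)
    | Sum.inl (Sum.inr (Sum.inl e)), Sum.inl (Sum.inr (Sum.inr e')) =>
        (e : Sym2 V) = (e' : Sym2 V)
    | Sum.inl (Sum.inr (Sum.inr _)), Sum.inr _ => True
    | _, _ => False


open scoped RealInnerProductSpace

section tetra

variable {E : Type*} [NormedAddCommGroup E] [InnerProductSpace ℝ E]

lemma aux_sq_sub (a b : E) (ha : ‖a‖ = 1) (hb : ‖b‖ = 1) :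
    ‖a - b‖ ^ 2 = 2 - 2 * ⟪a, b⟫ := by
  rw [norm_sub_sq_real, ha, hb]; ring

lemma aux_sum_sq (a b c d : E) (ha : ‖a‖ = 1) (hb : ‖b‖ = 1) (hc : ‖c‖ = 1) (hd : ‖d‖ = 1) :
    ‖a - b‖ ^ 2 + ‖a - c‖ ^ 2 + ‖b - c‖ ^ 2 + ‖a - d‖ ^ 2 + ‖b - d‖ ^ 2 + ‖c - d‖ ^ 2 ≤ 16 := by
  have h : 0 ≤ ‖a + b + c + d‖ ^ 2 := sq_nonneg _
  rw [norm_add_sq_real, norm_add_sq_real, norm_add_sq_real] at h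
  simp only [inner_add_left, ha, hb, hc, hd] at h
  rw [aux_sq_sub a b ha hb, aux_sq_sub a c ha hc, aux_sq_sub b c hb hc, aux_sq_sub a d ha hd,
    aux_sq_sub b d hb hd, aux_sq_sub c d hc hd]
  linarith

lemma aux_sqrt6 : Real.sqrt 6 ^ 2 = 6 ∧ 2.4 < Real.sqrt 6 ∧ Real.sqrt 6 < 2.45 := by
  refine ⟨Real.sq_sqrt (by norm_num), ?_, ?_⟩
  · apply Real.lt_sqrt_of_sq_lt; norm_num
  · rw [Real.sqrt_lt' (by norm_num)]; norm_num

lemma aux_dev (p q r s t u : ℝ) (h : p ^ 2 + q ^ 2 + r ^ 2 + s ^ 2 + t ^ 2 + u ^ 2 ≤ 16) :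
    (p - 2 * √6 / 3) ^ 2 + (q - 2 * √6 / 3) ^ 2 + (r - 2 * √6 / 3) ^ 2 + (s - 2 * √6 / 3) ^ 2
      + (t - 2 * √6 / 3) ^ 2 + (u - 2 * √6 / 3) ^ 2
      ≤ (4 * √6 / 3) * (4 * √6 - (p + q + r + s + t + u)) := by
  obtain ⟨h6, -, -⟩ := aux_sqrt6
  nlinarith

lemma aux_tetra_le (a b c d : E) (ha : ‖a‖ = 1) (hb : ‖b‖ = 1) (hc : ‖c‖ = 1) (hd : ‖d‖ = 1) :
    ‖a - b‖ + ‖a - c‖ + ‖b - c‖ + ‖a - d‖ + ‖b - d‖ + ‖c - d‖ ≤ 4 * √6 := by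
  have h := aux_dev _ _ _ _ _ _ (aux_sum_sq a b c d ha hb hc hd)
  obtain ⟨h6, h1, h2⟩ := aux_sqrt6
  by_contra! hlt
  have : 0 ≤ (4 * √6 / 3) * (4 * √6 -
      (‖a - b‖ + ‖a - c‖ + ‖b - c‖ + ‖a - d‖ + ‖b - d‖ + ‖c - d‖)) := le_trans (by positivity) h
  nlinarith

lemma aux_inner_of_dist (a b : E) (ha : ‖a‖ = 1) (hb : ‖b‖ = 1) (ε : ℝ) (hε : 0 ≤ ε)
    (h : (‖a - b‖ - 2 * √6 / 3) ^ 2 ≤ 6.6 * ε ^ 2) : |⟪a, b⟫ + 1 / 3| ≤ 5 * ε := by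
  obtain ⟨h6, h1, h2⟩ := aux_sqrt6
  have h3 : |‖a - b‖ - 2 * √6 / 3| ≤ 2.6 * ε := by
    apply abs_le_of_sq_le_sq _ (by positivity)
    nlinarith [sq_nonneg ε]
  have h4 := aux_sq_sub a b ha hb
  have h5 : ‖a - b‖ ≤ 2 := by
    have := norm_sub_le a b
    linarith
  have h7 : ⟪a, b⟫ + 1 / 3 = -((‖a - b‖ - 2 * √6 / 3) * (‖a - b‖ + 2 * √6 / 3)) / 2 := by
    nlinarith
  have h8 : |‖a - b‖ + 2 * √6 / 3| ≤ 3.7 := by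
    rw [abs_of_nonneg (by positivity)]; linarith
  rw [h7, abs_div, abs_neg, abs_mul, abs_two]
  have := mul_le_mul h3 h8 (abs_nonneg _) (by positivity)
  linarith

lemma aux_tetra (a b c d : E) (ha : ‖a‖ = 1) (hb : ‖b‖ = 1) (hc : ‖c‖ = 1) (hd : ‖d‖ = 1)
    (ε : ℝ) (hε : 0 ≤ ε)
    (h : 4 * √6 - 2 * ε ^ 2 ≤
      ‖a - b‖ + ‖a - c‖ + ‖b - c‖ + ‖a - d‖ + ‖b - d‖ + ‖c - d‖) :
    |⟪a, b⟫ + 1 / 3| ≤ 5 * ε ∧ |⟪a, d⟫ + 1 / 3| ≤ 5 * ε ∧ |⟪b, d⟫ + 1 / 3| ≤ 5 * ε := by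
  have h' := aux_dev _ _ _ _ _ _ (aux_sum_sq a b c d ha hb hc hd)
  obtain ⟨h6, h1, h2⟩ := aux_sqrt6
  have h3 : (4 * √6 / 3) * (4 * √6 -
      (‖a - b‖ + ‖a - c‖ + ‖b - c‖ + ‖a - d‖ + ‖b - d‖ + ‖c - d‖)) ≤ 6.6 * ε ^ 2 := by
    have : (4 * √6 / 3) * (4 * √6 -
      (‖a - b‖ + ‖a - c‖ + ‖b - c‖ + ‖a - d‖ + ‖b - d‖ + ‖c - d‖)) ≤
        (4 * √6 / 3) * (2 * ε ^ 2) := by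
      apply mul_le_mul_of_nonneg_left _ (by positivity)
      linarith
    nlinarith [sq_nonneg ε]
  have e1 := sq_nonneg (‖a - b‖ - 2 * √6 / 3)
  have e2 := sq_nonneg (‖a - c‖ - 2 * √6 / 3)
  have e3 := sq_nonneg (‖b - c‖ - 2 * √6 / 3)
  have e4 := sq_nonneg (‖a - d‖ - 2 * √6 / 3)
  have e5 := sq_nonneg (‖b - d‖ - 2 * √6 / 3)
  have e6 := sq_nonneg (‖c - d‖ - 2 * √6 / 3)
  refine ⟨aux_inner_of_dist a b ha hb ε hε ?_, aux_inner_of_dist a d ha hd ε hε ?_,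
    aux_inner_of_dist b d hb hd ε hε ?_⟩ <;> linarith

lemma aux_sink (a d t : E) (ha : ‖a‖ = 1) (hd : ‖d‖ = 1) (ht : ‖t‖ = 1)
    (ε : ℝ) (hε : 0 ≤ ε) (hε1 : ε ≤ 1 / 1000) (h : 2 - 2 * ε ^ 2 ≤ ‖d - t‖)
    (had : |⟪a, d⟫ + 1 / 3| ≤ 5 * ε) : |⟪a, t⟫ - 1 / 3| ≤ 8 * ε := by
  have h1 := aux_sq_sub d t hd ht
  have h2 : ‖d + t‖ ^ 2 = 2 + 2 * ⟪d, t⟫ := by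
    rw [norm_add_sq_real, hd, ht]; ring
  have h3 : ‖d + t‖ ^ 2 ≤ (3 * ε) ^ 2 := by
    have : (2 - 2 * ε ^ 2) ^ 2 ≤ ‖d - t‖ ^ 2 := by
      apply pow_le_pow_left₀ _ h
      nlinarith
    nlinarith [sq_nonneg ε]
  have h4 : ‖d + t‖ ≤ 3 * ε := (sq_le_sq₀ (norm_nonneg _) (by positivity)).1 h3
  have h5 : |⟪a, d + t⟫| ≤ 3 * ε := by
    have := abs_real_inner_le_norm a (d + t)
    rw [ha] at this
    linarith
  rw [inner_add_right] at h5
  rw [abs_le] at *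
  constructor <;> linarith [h5.1, h5.2, had.1, had.2]

end tetra

lemma aux_cube (y z : ℂ) :
    ‖y ^ 2 + y * z + z ^ 2‖ ^ 2 = (2 * (y.re * z.re + y.im * z.im)
      + (‖y‖ ^ 2 + ‖z‖ ^ 2) / 2) ^ 2 + 3 / 4 * (‖y‖ ^ 2 - ‖z‖ ^ 2) ^ 2 := by
  rw [← Complex.normSq_eq_norm_sq, ← Complex.normSq_eq_norm_sq, ← Complex.normSq_eq_norm_sq]
  simp only [Complex.normSq_apply, pow_two, Complex.add_re, Complex.add_im, Complex.mul_re,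
    Complex.mul_im]
  ring

/-- the planar estimate for one edge -/
lemma aux_planar (y z : ℂ) (p q σ ε : ℝ) (hε : 0 ≤ ε) (hε1 : ε ≤ 1 / 1000)
    (hp : |p - 1 / 3| ≤ 8 * ε) (hq : |q - 1 / 3| ≤ 8 * ε) (hσ : |σ + 1 / 3| ≤ 5 * ε)
    (hy : ‖y‖ ^ 2 + p ^ 2 = 1) (hz : ‖z‖ ^ 2 + q ^ 2 = 1)
    (hyz : y.re * z.re + y.im * z.im + p * q = σ) :
    ‖y ^ 3 - z ^ 3‖ ≤ 100 * ε ∧ 1 < ‖y - z‖ := by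
  have hyz2 : ‖y - z‖ ^ 2 = ‖y‖ ^ 2 + ‖z‖ ^ 2 - 2 * (y.re * z.re + y.im * z.im) := by
    rw [← Complex.normSq_eq_norm_sq, ← Complex.normSq_eq_norm_sq, ← Complex.normSq_eq_norm_sq]
    simp only [Complex.normSq_apply, Complex.sub_re, Complex.sub_im]
    ring
  have hc := aux_cube y z
  set s := y.re * z.re + y.im * z.im with hs
  rw [abs_le] at hp hq hσ
  have hA : |‖y‖ ^ 2 - 8 / 9| ≤ 11 / 2 * ε := by
    have e : ‖y‖ ^ 2 - 8 / 9 = - ((p - 1 / 3) * (p + 1 / 3)) := by linarith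
    have e1 : |p + 1 / 3| ≤ 0.68 := by rw [abs_le]; constructor <;> linarith [hp.1, hp.2]
    have e2 := mul_le_mul (abs_le.2 hp) e1 (abs_nonneg _) (by positivity)
    rw [e, abs_neg, abs_mul]
    linarith
  have hB : |‖z‖ ^ 2 - 8 / 9| ≤ 11 / 2 * ε := by
    have e : ‖z‖ ^ 2 - 8 / 9 = - ((q - 1 / 3) * (q + 1 / 3)) := by linarith
    have e1 : |q + 1 / 3| ≤ 0.68 := by rw [abs_le]; constructor <;> linarith [hq.1, hq.2]
    have e2 := mul_le_mul (abs_le.2 hq) e1 (abs_nonneg _) (by positivity)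
    rw [e, abs_neg, abs_mul]
    linarith
  have hpq : |p * q - 1 / 9| ≤ 11 * ε := by
    have e : p * q - 1 / 9 = (p - 1 / 3) * (q - 1 / 3) + (p - 1 / 3) / 3 + (q - 1 / 3) / 3 := by ring
    have : |(p - 1 / 3) * (q - 1 / 3)| ≤ (8 * ε) * (8 * ε) := by
      rw [abs_mul]
      exact mul_le_mul (abs_le.2 hp) (abs_le.2 hq) (abs_nonneg _) (by positivity)
    have h64 : (8 * ε) * (8 * ε) ≤ ε := by
      have := mul_le_mul_of_nonneg_left hε1 hε
      linarith
    rw [abs_le] at this ⊢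
    rw [e]
    constructor <;> linarith [this.1, this.2, hp.1, hp.2, hq.1, hq.2]
  rw [abs_le] at hA hB hpq
  have hy1 : ‖y‖ ≤ 1 := by
    rw [← sq_le_sq₀ (norm_nonneg _) (by positivity)]
    linarith [sq_nonneg p]
  have hz1 : ‖z‖ ≤ 1 := by
    rw [← sq_le_sq₀ (norm_nonneg _) (by positivity)]
    linarith [sq_nonneg q]
  constructor
  · have hn : ‖y ^ 2 + y * z + z ^ 2‖ ≤ 50 * ε := by
      rw [← sq_le_sq₀ (norm_nonneg _) (by positivity)]
      rw [hc]
      have h1 : (2 * s + (‖y‖ ^ 2 + ‖z‖ ^ 2) / 2) ^ 2 ≤ (43 * ε) ^ 2 := by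
        apply sq_le_sq'
        · linarith [hA.1, hB.1, hpq.1, hA.2, hB.2, hpq.2, hσ.1, hσ.2]
        · linarith [hA.1, hB.1, hpq.1, hA.2, hB.2, hpq.2, hσ.1, hσ.2]
      have h2 : (‖y‖ ^ 2 - ‖z‖ ^ 2) ^ 2 ≤ (22 * ε) ^ 2 := by
        apply sq_le_sq' <;> linarith [hA.1, hB.1, hA.2, hB.2]
      linarith [sq_nonneg ε, mul_pow 43 ε 2, mul_pow 22 ε 2, mul_pow 50 ε 2]
    have hd : ‖y - z‖ ≤ 2 := by linarith [norm_sub_le y z]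
    have : y ^ 3 - z ^ 3 = (y - z) * (y ^ 2 + y * z + z ^ 2) := by ring
    rw [this, norm_mul]
    have := mul_le_mul hd hn (norm_nonneg _) (by positivity)
    linarith
  · have : 1 < ‖y - z‖ ^ 2 := by
      rw [hyz2]
      linarith [hA.1, hB.1, hpq.1, hA.2, hB.2, hpq.2, hσ.1, hσ.2]
    by_contra! hle
    have := pow_le_one₀ (n := 2) (norm_nonneg (y - z)) hle
    linarith

lemma aux_roots : ∃ w : ℂ, ∀ y p : ℂ, ‖y ^ 3 - p ^ 3‖ < 1 / 8 →
    ∃ k : Fin 3, ‖y - w ^ (k : ℕ) * p‖ < 1 / 2 := by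
  have h3 : √3 * √3 = 3 := Real.mul_self_sqrt (by norm_num)
  have hw : (⟨-1 / 2, √3 / 2⟩ : ℂ) ^ 2 = -1 - ⟨-1 / 2, √3 / 2⟩ := by
    apply Complex.ext
    · simp [pow_two]; linarith
    · simp [pow_two]; ring
  refine ⟨⟨-1 / 2, √3 / 2⟩, ?_⟩
  generalize (⟨-1 / 2, √3 / 2⟩ : ℂ) = w at *
  intro y p h
  by_contra! hk
  have e : y ^ 3 - p ^ 3 = (y - w ^ 0 * p) * (y - w ^ 1 * p) * (y - w ^ 2 * p) := by
    rw [hw]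
    linear_combination ((y - p) * p ^ 2) * hw
  rw [e, norm_mul, norm_mul] at h
  have k0 := hk 0
  have k1 := hk 1
  have k2 := hk 2
  have := mul_le_mul (mul_le_mul k0 k1 (by norm_num) (norm_nonneg _)) k2 (by norm_num) (by positivity)
  norm_num at this h
  linarith

lemma aux_walk {V : Type} (G : SimpleGraph V) (y : V → ℂ) (η : ℝ)
    (h : ∀ u v, G.Adj u v → ‖y u ^ 3 - y v ^ 3‖ ≤ η) {u v : V} (p : G.Walk u v) :
    ‖y u ^ 3 - y v ^ 3‖ ≤ p.length * η := by
  induction p with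
  | nil => simp
  | cons hadj p ih =>
    rename_i a b c
    have := norm_sub_le_norm_sub_add_norm_sub (y a ^ 3) (y b ^ 3) (y c ^ 3)
    have h1 := h _ _ hadj
    rw [SimpleGraph.Walk.length_cons]; push_cast
    linarith

lemma aux_color {V : Type} [Fintype V] (G : SimpleGraph V) [Fintype G.edgeSet] (y : V → ℂ) (η : ℝ)
    (hη : 0 ≤ η) (hm : G.edgeFinset.card * η < 1 / 8)
    (h : ∀ u v, G.Adj u v → ‖y u ^ 3 - y v ^ 3‖ ≤ η ∧ 1 < ‖y u - y v‖) : G.Colorable 3 := by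
  obtain ⟨w, hw⟩ := aux_roots
  let r : V → V := fun v => (G.connectedComponentMk v).out
  have hr : ∀ v, ‖y v ^ 3 - y (r v) ^ 3‖ < 1 / 8 := by
    intro v
    have hre : G.Reachable v (r v) := by
      apply SimpleGraph.ConnectedComponent.exact
      exact (Quot.out_eq _).symm
    obtain ⟨p, hp⟩ := hre.exists_isPath
    have h1 := aux_walk G y η (fun u v huv => (h u v huv).1) p
    have h2 : p.length ≤ G.edgeFinset.card := by
      have := hp.isTrail.length_le_card_edgeFinset
      convert this
    have : (p.length : ℝ) * η ≤ G.edgeFinset.card * η := by gcongr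
    linarith
  choose col hcol using fun v => hw (y v) (y (r v)) (hr v)
  refine ⟨SimpleGraph.Coloring.mk col ?_⟩
  intro u v huv he
  have h1 := hcol u
  have h2 := hcol v
  have hruv : r u = r v := by
    simp only [r]
    rw [SimpleGraph.ConnectedComponent.sound huv.reachable]
  rw [he, hruv] at h1
  have h3 := (h u v huv).2
  have := norm_sub_le_norm_sub_add_norm_sub (y u) (w ^ (col v : ℕ) * y (r v)) (y v)
  rw [norm_sub_rev (w ^ (col v : ℕ) * y (r v)) (y v)] at this
  linarith

lemma aux_coords (t : EuclideanSpace ℝ (Fin 3)) (ht : ‖t‖ = 1) :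
    ∃ Y : EuclideanSpace ℝ (Fin 3) → ℂ, ∀ x z,
      (Y x).re * (Y z).re + (Y x).im * (Y z).im + ⟪x, t⟫ * ⟪z, t⟫ = ⟪x, z⟫ := by
  have ho : Orthonormal ℝ ((({0} : Set (Fin 3))).domRestrict (fun _ : Fin 3 => t)) := by
    constructor
    · intro i; exact ht
    · intro i j hij
      exact absurd (Subsingleton.elim i j) hij
  obtain ⟨b, hb⟩ := ho.exists_orthonormalBasis_extension_of_card_eq (by simp)
  have hb0 : b 0 = t := hb 0 rfl
  refine ⟨fun x => ⟨⟪x, b 1⟫, ⟪x, b 2⟫⟩, fun x z => ?_⟩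
  rw [← b.sum_inner_mul_inner x z, Fin.sum_univ_three, hb0]
  simp only [real_inner_comm z]
  ring

lemma aux_norm3 (v : Fin 3 → ℝ) : norm3 v = ‖(WithLp.toLp 2 v : EuclideanSpace ℝ (Fin 3))‖ := by
  rw [EuclideanSpace.norm_eq]
  simp [norm3]

lemma aux_sum_mem {V : Type} [Fintype V] (a b : V) (hab : a ≠ b) (f : V → ℝ) :
    (∑ u, if u ∈ s(a, b) then f u else 0) = f a + f b := by
  have : ∀ u, (if u ∈ s(a, b) then f u else 0)
      = (if u = a then f u else 0) + (if u = b then f u else 0) := by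
    intro u
    simp only [Sym2.mem_iff]
    by_cases h1 : u = a
    · subst h1; simp [hab]
    · by_cases h2 : u = b
      · subst h2; simp [h1]
      · simp [h1, h2]
  simp only [this, Finset.sum_add_distrib]
  simp

lemma aux_sum_pair {V : Type} [Fintype V] (a b : V) (hab : a ≠ b) (f : V → V → ℝ) :
    (∑ u, ∑ v, if s(u, v) = s(a, b) then f u v else 0) = f a b + f b a := by
  have : ∀ u v, (if s(u, v) = s(a, b) then f u v else 0)
      = (if u = a then (if v = b then f u v else 0) else 0)
        + (if u = b then (if v = a then f u v else 0) else 0) := by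
    intro u v
    simp only [Sym2.eq_iff]
    by_cases h1 : u = a
    · subst h1; simp [hab]
    · by_cases h2 : u = b
      · subst h2; simp [h1]
      · simp [h1, h2]
  simp only [this, Finset.sum_add_distrib]
  simp

lemma aux_sum_adj {V : Type} [Fintype V] (G : SimpleGraph V) [Fintype G.edgeSet] (f : V → V → ℝ) :
    (∑ u, ∑ v, if G.Adj u v then f u v else 0)
      = ∑ e : G.edgeSet, ∑ u, ∑ v, if s(u, v) = (e : Sym2 V) then f u v else 0 := by
  symm
  rw [Finset.sum_comm]
  refine Finset.sum_congr rfl fun u _ => ?_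
  rw [Finset.sum_comm]
  refine Finset.sum_congr rfl fun v _ => ?_
  by_cases h : G.Adj u v
  · rw [if_pos h, Finset.sum_eq_single (⟨s(u, v), h⟩ : G.edgeSet)]
    · simp
    · intro e _ he
      rw [if_neg]
      intro h'
      exact he (Subtype.ext h'.symm)
    · simp
  · rw [if_neg h]
    apply Finset.sum_eq_zero
    intro e _
    rw [if_neg]
    intro h'
    apply h
    have := e.2
    rw [← h'] at this
    exact this

/-- rewriting the objective as a sum over the edges of `G`. -/
lemma aux_decomp {V : Type} [Fintype V] (G : SimpleGraph V) [Fintype G.edgeSet]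
    (D : ((V ⊕ (G.edgeSet ⊕ G.edgeSet)) ⊕ Unit) → ((V ⊕ (G.edgeSet ⊕ G.edgeSet)) ⊕ Unit) → ℝ)
    (hD : ∀ a b, D a b = D b a) (a b : G.edgeSet → V)
    (hab : ∀ e : G.edgeSet, s(a e, b e) = (e : Sym2 V)) :
    (1 / 4) * (∑ u, ∑ v, if (cliqueSinkGadget G).Adj u v then D u v else 0) =
      ∑ e : G.edgeSet, (1 / 2) * (
        D (.inl (.inl (a e))) (.inl (.inl (b e)))
        + D (.inl (.inl (a e))) (.inl (.inr (.inl e)))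
        + D (.inl (.inl (b e))) (.inl (.inr (.inl e)))
        + D (.inl (.inl (a e))) (.inl (.inr (.inr e)))
        + D (.inl (.inl (b e))) (.inl (.inr (.inr e)))
        + D (.inl (.inr (.inl e))) (.inl (.inr (.inr e)))
        + D (.inl (.inr (.inr e))) (.inr ())) := by
  have hne : ∀ e, a e ≠ b e := by
    intro e h
    have h2 := e.2
    rw [← hab e, h] at h2
    exact G.loopless.irrefl _ h2
  have hVV : ∀ u v : V, (cliqueSinkGadget G).Adj (.inl (.inl u)) (.inl (.inl v)) ↔ G.Adj u v := by
    intro u v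
    simp only [cliqueSinkGadget, SimpleGraph.fromRel_adj]
    constructor
    · rintro ⟨_, h | h⟩
      exacts [h, h.symm]
    · intro h
      exact ⟨by simpa using h.ne, Or.inl h⟩
  simp only [Fintype.sum_sum_type, hVV]
  simp only [cliqueSinkGadget, SimpleGraph.fromRel_adj]
  simp only [ne_eq, reduceCtorEq, not_false_eq_true, true_and, or_false, false_or, and_false,
    if_false, Finset.sum_const_zero, add_zero, zero_add, and_true, or_self, if_true,
    Finset.univ_unique, Finset.sum_singleton, Subtype.coe_inj, Finset.sum_add_distrib,
    Sum.inl.injEq, Sum.inr.injEq]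
  have hmem : ∀ f : V → G.edgeSet → ℝ, (∑ e : G.edgeSet, ∑ u, if u ∈ (e : Sym2 V) then f u e else 0)
      = ∑ e, (f (a e) e + f (b e) e) := by
    intro f
    refine Finset.sum_congr rfl fun e _ => ?_
    rw [← hab e]
    exact aux_sum_mem _ _ (hne e) _
  have hpair : (∑ u, ∑ v, if G.Adj u v then D (.inl (.inl u)) (.inl (.inl v)) else 0)
      = ∑ e, (D (.inl (.inl (a e))) (.inl (.inl (b e)))
        + D (.inl (.inl (b e))) (.inl (.inl (a e)))) := by
    rw [aux_sum_adj]
    refine Finset.sum_congr rfl fun e _ => ?_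
    rw [← hab e]
    exact aux_sum_pair _ _ (hne e) (fun u v => D (.inl (.inl u)) (.inl (.inl v)))
  rw [hpair]
  have hk := hmem fun u e => D (.inl (.inl u)) (.inl (.inr (.inl e)))
  have ht := hmem fun u e => D (.inl (.inl u)) (.inl (.inr (.inr e)))
  have hk' := hmem fun u e => D (.inl (.inr (.inl e))) (.inl (.inl u))
  have ht' := hmem fun u e => D (.inl (.inr (.inr e))) (.inl (.inl u))
  rw [Finset.sum_comm] at hk ht
  rw [hk, ht, hk', ht']
  simp only [Finset.sum_ite_eq, Finset.sum_ite_eq', Finset.mem_univ, if_true,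
    ← Finset.sum_add_distrib, Finset.mul_sum]
  refine Finset.sum_congr rfl fun e _ => ?_
  rw [hD (.inl (.inl (b e))) (.inl (.inl (a e))), hD (.inl (.inr (.inl e))) (.inl (.inl (a e))),
    hD (.inl (.inr (.inl e))) (.inl (.inl (b e))), hD (.inl (.inr (.inr e))) (.inl (.inl (a e))),
    hD (.inl (.inr (.inr e))) (.inl (.inl (b e))), hD (.inl (.inr (.inr e))) (.inl (.inr (.inl e))),
    hD (.inr default)]
  ring

/-- There is a constant `c > 0` such that whenever
`WLMC_I(H) ≥ 2√6·m + m - c/m²` (with `m ≥ 1`), the graph `G` is 3-colorable. -/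
theorem stmt13 :
    ∃ c : ℝ, c > 0 ∧
      ∀ (V : Type) [Fintype V] [DecidableEq V] (G : SimpleGraph V)
        [DecidableRel G.Adj],
        1 ≤ G.edgeFinset.card →
        wlmc (1 : Matrix (Fin 3) (Fin 3) ℝ) (cliqueSinkGadget G) ≥
          2 * Real.sqrt 6 * G.edgeFinset.card + G.edgeFinset.card -
            c / (G.edgeFinset.card : ℝ) ^ 2 →
        G.Colorable 3 := by
  refine ⟨1 / 2000000, by norm_num, ?_⟩
  intro V _ _ G _ hm hw
  set m : ℝ := (G.edgeFinset.card : ℝ) with hmdef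
  have hm1 : (1 : ℝ) ≤ m := by rw [hmdef]; exact_mod_cast hm
  have hm0 : 0 < m := by linarith
  obtain ⟨ε, hεdef⟩ : ∃ ε : ℝ, ε = 1 / 1000 / m := ⟨_, rfl⟩
  have hε0 : 0 < ε := by rw [hεdef]; positivity
  have hε1 : ε ≤ 1 / 1000 := by rw [hεdef]; exact div_le_self (by norm_num) hm1
  have hεc : 1 / 2000000 / m ^ 2 = ε ^ 2 / 2 := by rw [hεdef]; field_simp; norm_num
  have hmε : m * ε = 1 / 1000 := by rw [hεdef]; field_simp
  rw [hεc] at hw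
  have hlt : 2 * √6 * m + m - ε ^ 2 < wlmc (1 : Matrix (Fin 3) (Fin 3) ℝ) (cliqueSinkGadget G) := by
    have := pow_pos hε0 2
    linarith
  unfold wlmc at hlt
  obtain ⟨_, ⟨x, hx, rfl⟩, hlt⟩ := exists_lt_of_lt_csSup
    (by exact ⟨_, fun _ => ![1, 0, 0], fun _ => by simp [norm3, Fin.sum_univ_three], rfl⟩) hlt
  simp only [Matrix.one_mulVec, aux_norm3, WithLp.toLp_sub] at hlt hx
  obtain ⟨X, hX⟩ : ∃ X : ((V ⊕ (G.edgeSet ⊕ G.edgeSet)) ⊕ Unit) → EuclideanSpace ℝ (Fin 3),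
      ∀ u, X u = WithLp.toLp 2 (x u) := ⟨_, fun _ => rfl⟩
  simp only [← hX] at hlt hx
  choose a b hab using fun e : G.edgeSet =>
    (show ∃ a b, s(a, b) = (e : Sym2 V) from
      Sym2.ind (f := fun z => ∃ a b, s(a, b) = z) (fun a b => ⟨a, b, rfl⟩) (e : Sym2 V))
  rw [aux_decomp G (fun u v => ‖X u - X v‖) (fun u v => norm_sub_rev _ _) a b hab] at hlt
  set F : G.edgeSet → ℝ := fun e => ‖X (.inl (.inl (a e))) - X (.inl (.inl (b e)))‖
        + ‖X (.inl (.inl (a e))) - X (.inl (.inr (.inl e)))‖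
        + ‖X (.inl (.inl (b e))) - X (.inl (.inr (.inl e)))‖
        + ‖X (.inl (.inl (a e))) - X (.inl (.inr (.inr e)))‖
        + ‖X (.inl (.inl (b e))) - X (.inl (.inr (.inr e)))‖
        + ‖X (.inl (.inr (.inl e))) - X (.inl (.inr (.inr e)))‖ with hF
  set T : G.edgeSet → ℝ := fun e => ‖X (.inl (.inr (.inr e))) - X (.inr ())‖ with hT
  have hlt' : 2 * √6 * m + m - ε ^ 2 < ∑ e, (1 / 2) * (F e + T e) := hlt
  have hFle : ∀ e, F e ≤ 4 * √6 := fun e => aux_tetra_le _ _ _ _ (hx _) (hx _) (hx _) (hx _)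
  have hTle : ∀ e, T e ≤ 2 := by
    intro e
    have := norm_sub_le (X (.inl (.inr (.inr e)))) (X (.inr ()))
    rw [hx, hx] at this
    simp only [hT]; linarith
  have hcard : ∑ _e : G.edgeSet, (2 * √6 + 1) = 2 * √6 * m + m := by
    rw [Finset.sum_const, Finset.card_univ, nsmul_eq_mul, hmdef, SimpleGraph.edgeFinset_card]
    ring
  have hdef : ∀ e, (2 * √6 + 1) - (1 / 2) * (F e + T e) ≤ ε ^ 2 := by
    intro e
    have h1 : (2 * √6 + 1) - (1 / 2) * (F e + T e) ≤
        ∑ e : G.edgeSet, ((2 * √6 + 1) - (1 / 2) * (F e + T e)) :=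
      Finset.single_le_sum (f := fun e => (2 * √6 + 1) - (1 / 2) * (F e + T e))
        (fun i _ => by linarith [hFle i, hTle i]) (Finset.mem_univ e)
    rw [Finset.sum_sub_distrib, hcard] at h1
    linarith
  obtain ⟨Y, hY⟩ := aux_coords (X (.inr ())) (hx _)
  have hnorm : ∀ u, ‖Y (X u)‖ ^ 2 + ⟪X u, X (.inr ())⟫ ^ 2 = 1 := by
    intro u
    have := hY (X u) (X u)
    rw [real_inner_self_eq_norm_sq, hx u] at this
    rw [← Complex.normSq_eq_norm_sq, Complex.normSq_apply]
    linarith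
  have key : ∀ e, ‖Y (X (.inl (.inl (a e)))) ^ 3 - Y (X (.inl (.inl (b e)))) ^ 3‖ ≤ 100 * ε ∧
      1 < ‖Y (X (.inl (.inl (a e)))) - Y (X (.inl (.inl (b e))))‖ := by
    intro e
    have hd := hdef e
    have hFe := hFle e
    have hTe := hTle e
    obtain ⟨h1, h2, h3⟩ := aux_tetra (X (.inl (.inl (a e)))) (X (.inl (.inl (b e))))
      (X (.inl (.inr (.inl e)))) (X (.inl (.inr (.inr e)))) (hx _) (hx _) (hx _) (hx _) ε hε0.le
      (by change _ ≤ F e; linarith)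
    have hTT : 2 - 2 * ε ^ 2 ≤ ‖X (.inl (.inr (.inr e))) - X (.inr ())‖ := by
      change _ ≤ T e; linarith
    have h4 := aux_sink _ _ _ (hx _) (hx _) (hx _) ε hε0.le hε1 hTT h2
    have h5 := aux_sink _ _ _ (hx _) (hx _) (hx _) ε hε0.le hε1 hTT h3
    exact aux_planar _ _ _ _ _ ε hε0.le hε1 h4 h5 h1 (hnorm _) (hnorm _) (hY _ _)
  refine aux_color G (fun v => Y (X (.inl (.inl v)))) (100 * ε) (by positivity) ?_ ?_
  · have : m * (100 * ε) = 1 / 10 := by linarith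
    have h' : m * (100 * ε) < 1 / 8 := by rw [this]; norm_num
    exact h'
  · intro u v huv
    have he := hab ⟨s(u, v), huv⟩
    have hk := key ⟨s(u, v), huv⟩
    rcases Sym2.eq_iff.1 he with ⟨h1, h2⟩ | ⟨h1, h2⟩
    · rw [h1, h2] at hk
      exact hk
    · rw [h1, h2, norm_sub_rev, norm_sub_rev (Y (X (.inl (.inl v))))] at hk
      exact hk
end

section
/- Let W = diag(1, β, γ) with 1 > β ≥ γ ≥ 0. There exists N (depending only on β) such that the following holds for every finite simple graph G = (V, E) with n ≥ N vertices and m ≥ 1 edges. Let K = m³·n and construct the graph H by attaching to each vertex v ∈ V exactly K new leaf vertices, each adjacent only to v (so v becomes the center of a K-star). Then for every integer C > 1: if WLMC_W(H) > C + K·n − 1/2, then MC(G) ≥ C. -/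
open scoped Classical

/-- The max-cut value of a finite simple graph: the maximum, over ±1-labelings
(modeled by `Bool`-labelings), of the number of edges whose endpoints get different
labels (each cut edge is counted twice in the double sum, whence the division by 2). -/
noncomputable def maxCut {V : Type} [Fintype V] (G : SimpleGraph V) : ℕ :=
  sSup {k : ℕ | ∃ y : V → Bool,
    k = (∑ u, ∑ v, if G.Adj u v ∧ y u ≠ y v then 1 else 0) / 2}

/-- The graph obtained from `G` by attaching `K` new leaves to every vertex, so that
each vertex of `G` becomes the center of a `K`-star. -/
def addLeaves {V : Type} (G : SimpleGraph V) (K : ℕ) : SimpleGraph (V ⊕ V × Fin K) :=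
  SimpleGraph.fromRel fun a b =>
    match a, b with
    | Sum.inl u, Sum.inl v => G.Adj u v
    | Sum.inl u, Sum.inr (v, _) => u = v
    | _, _ => False

lemma norm3_eq (v : Fin 3 → ℝ) : norm3 v = ‖WithLp.toLp 2 v‖ := by
  rw [EuclideanSpace.norm_eq]
  simp [norm3]

lemma norm3_add_le (v w : Fin 3 → ℝ) : norm3 (v + w) ≤ norm3 v + norm3 w := by
  simp only [norm3_eq, WithLp.toLp_add]
  exact norm_add_le _ _

lemma norm3_sub_le (v w : Fin 3 → ℝ) : norm3 (v - w) ≤ norm3 v + norm3 w := by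
  simp only [norm3_eq, WithLp.toLp_sub]
  exact norm_sub_le _ _

lemma norm3_sub_comm (v w : Fin 3 → ℝ) : norm3 (v - w) = norm3 (w - v) := by
  simp only [norm3_eq, WithLp.toLp_sub]
  exact norm_sub_rev _ _

lemma unit_sq {x : Fin 3 → ℝ} (h : norm3 x = 1) : x 0 ^ 2 + x 1 ^ 2 + x 2 ^ 2 = 1 := by
  unfold norm3 at h
  rw [Real.sqrt_eq_one, Fin.sum_univ_three] at h
  exact h

lemma stretch_norm_le {β γ : ℝ} (hβ : β < 1) (hγβ : γ ≤ β) (hγ : 0 ≤ γ)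
    {x : Fin 3 → ℝ} (h : norm3 x = 1) :
    norm3 ((Matrix.diagonal ![1, β, γ]).mulVec x) ≤ 1 - (1 - β ^ 2) * (1 - x 0 ^ 2) / 2 := by
  have hu := unit_sq h
  have h0 : 0 ≤ 1 - x 0 ^ 2 := by nlinarith [sq_nonneg (x 1), sq_nonneg (x 2)]
  have hb : 0 ≤ 1 - β ^ 2 := by nlinarith
  have hgb : γ ^ 2 ≤ β ^ 2 := by nlinarith
  have hp : (1 - β ^ 2) * (1 - x 0 ^ 2) ≤ 1 := by
    nlinarith [sq_nonneg β, sq_nonneg (x 0), mul_nonneg (sq_nonneg β) h0]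
  unfold norm3
  apply Real.sqrt_le_iff.2
  refine ⟨by linarith, ?_⟩
  simp only [Matrix.mulVec_diagonal, Fin.sum_univ_three]
  simp
  have h2 := mul_le_mul_of_nonneg_right hgb (sq_nonneg (x 2))
  have e : x 1 ^ 2 = 1 - x 0 ^ 2 - x 2 ^ 2 := by linarith
  have : x 0 ^ 2 + (β * x 1) ^ 2 + (γ * x 2) ^ 2 ≤ 1 - (1 - β ^ 2) * (1 - x 0 ^ 2) := by
    rw [mul_pow, mul_pow, e]
    nlinarith
  nlinarith [sq_nonneg ((1 - β ^ 2) * (1 - x 0 ^ 2))]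

lemma leaf_le {β γ : ℝ} (hβ : β < 1) (hγβ : γ ≤ β) (hγ : 0 ≤ γ)
    {x y : Fin 3 → ℝ} (h : norm3 x = 1) (hy : norm3 y = 1) :
    norm3 ((Matrix.diagonal ![1, β, γ]).mulVec x - (Matrix.diagonal ![1, β, γ]).mulVec y)
      ≤ 2 - (1 - β ^ 2) * (1 - x 0 ^ 2) / 2 := by
  have h1 := stretch_norm_le hβ hγβ hγ h
  have h2 := stretch_norm_le hβ hγβ hγ hy
  have h3 := norm3_sub_le ((Matrix.diagonal ![1, β, γ]).mulVec x)
    ((Matrix.diagonal ![1, β, γ]).mulVec y)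
  have hu := unit_sq hy
  have h0 : 0 ≤ 1 - y 0 ^ 2 := by nlinarith [sq_nonneg (y 1), sq_nonneg (y 2)]
  have hb : 0 ≤ 1 - β ^ 2 := by nlinarith
  have := mul_nonneg hb h0
  linarith

lemma rest_le {β γ : ℝ} (hβ : β < 1) (hγβ : γ ≤ β) (hγ : 0 ≤ γ)
    {x : Fin 3 → ℝ} (h : norm3 x = 1) :
    norm3 ![0, β * x 1, γ * x 2] ≤ √(1 - x 0 ^ 2) := by
  have hu := unit_sq h
  unfold norm3
  apply Real.sqrt_le_sqrt
  have hb : β ^ 2 ≤ 1 := by nlinarith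
  have hg : γ ^ 2 ≤ 1 := by nlinarith
  simp [Fin.sum_univ_three]
  nlinarith [mul_le_mul_of_nonneg_right hb (sq_nonneg (x 1)),
    mul_le_mul_of_nonneg_right hg (sq_nonneg (x 2))]

lemma abs_diff_le {a b : ℝ} (ha : a ^ 2 ≤ 1) (hb : b ^ 2 ≤ 1) :
    |a - b| ≤ (if decide (0 ≤ a) ≠ decide (0 ≤ b) then 2 else 0)
      + √(1 - a ^ 2) + √(1 - b ^ 2) := by
  have key : ∀ c : ℝ, c ^ 2 ≤ 1 → 1 - |c| ≤ √(1 - c ^ 2) ∧ |c| ≤ 1 := by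
    intro c hc
    have h1 : |c| ≤ 1 := by
      rw [← sq_abs] at hc
      nlinarith [abs_nonneg c]
    refine ⟨Real.le_sqrt_of_sq_le ?_, h1⟩
    rw [← sq_abs c]
    nlinarith [abs_nonneg c]
  obtain ⟨a1, a2⟩ := key a ha
  obtain ⟨b1, b2⟩ := key b hb
  have sa := Real.sqrt_nonneg (1 - a ^ 2)
  have sb := Real.sqrt_nonneg (1 - b ^ 2)
  rw [abs_le]
  by_cases h1 : 0 ≤ a <;> by_cases h2 : 0 ≤ b
  · simp [h1, h2]
    rw [abs_of_nonneg h1] at *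
    rw [abs_of_nonneg h2] at *
    constructor <;> linarith
  · simp [h1, h2]
    rw [abs_le] at a2 b2
    constructor <;> linarith
  · simp [h1, h2]
    rw [abs_le] at a2 b2
    constructor <;> linarith
  · simp [h1, h2]
    rw [abs_of_neg (not_le.1 h1)] at *
    rw [abs_of_neg (not_le.1 h2)] at *
    constructor <;> linarith

lemma edge_le {β γ : ℝ} (hβ : β < 1) (hγβ : γ ≤ β) (hγ : 0 ≤ γ)
    {x y : Fin 3 → ℝ} (h : norm3 x = 1) (hy : norm3 y = 1) :
    norm3 ((Matrix.diagonal ![1, β, γ]).mulVec x - (Matrix.diagonal ![1, β, γ]).mulVec y)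
      ≤ (if decide (0 ≤ x 0) ≠ decide (0 ≤ y 0) then 2 else 0)
        + 2 * √(1 - x 0 ^ 2) + 2 * √(1 - y 0 ^ 2) := by
  have hx2 : x 0 ^ 2 ≤ 1 := by nlinarith [unit_sq h, sq_nonneg (x 1), sq_nonneg (x 2)]
  have hy2 : y 0 ^ 2 ≤ 1 := by nlinarith [unit_sq hy, sq_nonneg (y 1), sq_nonneg (y 2)]
  have e : (Matrix.diagonal ![1, β, γ]).mulVec x - (Matrix.diagonal ![1, β, γ]).mulVec y
      = ![x 0 - y 0, 0, 0] + (![0, β * x 1, γ * x 2] - ![0, β * y 1, γ * y 2]) := by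
    ext i
    simp only [Pi.sub_apply, Pi.add_apply, Matrix.mulVec_diagonal]
    fin_cases i <;> simp
  have e0 : norm3 ![x 0 - y 0, 0, 0] = |x 0 - y 0| := by
    simp [norm3, Fin.sum_univ_three, Real.sqrt_sq_eq_abs]
  rw [e]
  have h1 := norm3_add_le ![x 0 - y 0, 0, 0] (![0, β * x 1, γ * x 2] - ![0, β * y 1, γ * y 2])
  have h2 := norm3_sub_le ![0, β * x 1, γ * x 2] ![0, β * y 1, γ * y 2]
  have h3 := rest_le hβ hγβ hγ h
  have h4 := rest_le hβ hγβ hγ hy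
  have h5 := abs_diff_le hx2 hy2
  linarith

lemma addLeaves_ll {V : Type} (G : SimpleGraph V) (K : ℕ) (u v : V) :
    (addLeaves G K).Adj (Sum.inl u) (Sum.inl v) ↔ G.Adj u v := by
  simp only [addLeaves, SimpleGraph.fromRel_adj]
  constructor
  · rintro ⟨_, h | h⟩
    · exact h
    · exact h.symm
  · intro h
    exact ⟨by simpa using h.ne, Or.inl h⟩

lemma addLeaves_lr {V : Type} (G : SimpleGraph V) (K : ℕ) (u : V) (p : V × Fin K) :
    (addLeaves G K).Adj (Sum.inl u) (Sum.inr p) ↔ u = p.1 := by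
  obtain ⟨v, i⟩ := p
  simp [addLeaves, SimpleGraph.fromRel_adj]

lemma addLeaves_rl {V : Type} (G : SimpleGraph V) (K : ℕ) (u : V) (p : V × Fin K) :
    (addLeaves G K).Adj (Sum.inr p) (Sum.inl u) ↔ u = p.1 := by
  rw [SimpleGraph.adj_comm, addLeaves_lr]

lemma addLeaves_rr {V : Type} (G : SimpleGraph V) (K : ℕ) (p q : V × Fin K) :
    ¬ (addLeaves G K).Adj (Sum.inr p) (Sum.inr q) := by
  simp [addLeaves, SimpleGraph.fromRel_adj]

lemma sum_adj {V : Type} [Fintype V] (G : SimpleGraph V) [DecidableRel G.Adj] :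
    (∑ u, ∑ v, if G.Adj u v then 1 else 0 : ℕ) = 2 * G.edgeFinset.card := by
  rw [← SimpleGraph.sum_degrees_eq_twice_card_edges]
  refine Finset.sum_congr rfl fun u _ => ?_
  rw [← SimpleGraph.card_neighborFinset_eq_degree, SimpleGraph.neighborFinset_eq_filter,
    Finset.card_filter]

lemma cut_le {V : Type} [Fintype V] (G : SimpleGraph V) (y : V → Bool) :
    (∑ u, ∑ v, if G.Adj u v ∧ y u ≠ y v then 1 else 0 : ℕ) ≤ 2 * maxCut G := by
  let G' : SimpleGraph V :=
    { Adj := fun u v => G.Adj u v ∧ y u ≠ y v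
      symm := ⟨fun u v h => ⟨h.1.symm, h.2.symm⟩⟩
      loopless := ⟨fun u h => h.2 rfl⟩ }
  have h1 : (∑ u, ∑ v, if G.Adj u v ∧ y u ≠ y v then 1 else 0 : ℕ)
      = 2 * G'.edgeFinset.card := by
    rw [← sum_adj G']
  have h2 : (∑ u, ∑ v, if G.Adj u v ∧ y u ≠ y v then 1 else 0 : ℕ) / 2 ≤ maxCut G := by
    unfold maxCut
    apply le_csSup
    · apply Set.Finite.bddAbove
      refine (Set.finite_range (fun y : V → Bool =>
        (∑ u, ∑ v, if G.Adj u v ∧ y u ≠ y v then 1 else 0 : ℕ) / 2)).subset ?_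
      rintro k ⟨y, rfl⟩
      exact ⟨y, rfl⟩
    · exact ⟨y, rfl⟩
  omega

/-- Splitting the sum over the leaf-extended graph. -/
lemma sum_split {V : Type} [Fintype V] (G : SimpleGraph V) (K : ℕ)
    (f : V ⊕ V × Fin K → V ⊕ V × Fin K → ℝ) (hf : ∀ a b, f a b = f b a) :
    (∑ a, ∑ b, if (addLeaves G K).Adj a b then f a b else 0)
      = (∑ u, ∑ v, if G.Adj u v then f (Sum.inl u) (Sum.inl v) else 0)
        + 2 * ∑ v, ∑ i, f (Sum.inl v) (Sum.inr (v, i)) := by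
  simp only [Fintype.sum_sum_type, addLeaves_ll, addLeaves_lr, addLeaves_rl, addLeaves_rr,
    if_false, Finset.sum_const_zero, add_zero, Finset.sum_add_distrib]
  have h1 : (∑ u : V, ∑ p : V × Fin K, if u = p.1 then f (Sum.inl u) (Sum.inr p) else 0)
      = ∑ v, ∑ i, f (Sum.inl v) (Sum.inr (v, i)) := by
    rw [Finset.sum_comm, Fintype.sum_prod_type]
    simp
  have h2 : (∑ p : V × Fin K, ∑ u : V, if u = p.1 then f (Sum.inr p) (Sum.inl u) else 0)
      = ∑ v, ∑ i, f (Sum.inl v) (Sum.inr (v, i)) := by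
    rw [Fintype.sum_prod_type]
    simp [hf (Sum.inr _)]
  rw [h1, h2]
  ring

lemma value_le {β γ : ℝ} (hβ : β < 1) (hγβ : γ ≤ β) (hγ : 0 ≤ γ)
    {V : Type} [Fintype V] (G : SimpleGraph V) [inst : DecidableRel G.Adj] (K : ℕ) (hK : 0 < K)
    (x : V ⊕ V × Fin K → Fin 3 → ℝ) (hx : ∀ u, norm3 (x u) = 1) :
    (1 / 4) * (∑ u, ∑ v, if (addLeaves G K).Adj u v then
      norm3 ((Matrix.diagonal ![1, β, γ]).mulVec (x u)
        - (Matrix.diagonal ![1, β, γ]).mulVec (x v)) else 0)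
      ≤ maxCut G + K * Fintype.card V
        + 4 * (G.edgeFinset.card : ℝ) ^ 2 / (K * (1 - β ^ 2)) := by
  obtain rfl : inst = fun a b => Classical.propDecidable _ := Subsingleton.elim _ _
  have hδ : 0 < 1 - β ^ 2 := by nlinarith
  have hKr : (0 : ℝ) < K := by exact_mod_cast hK
  set δ := 1 - β ^ 2 with hδd
  rw [sum_split G K (fun u v => norm3 ((Matrix.diagonal ![1, β, γ]).mulVec (x u)
        - (Matrix.diagonal ![1, β, γ]).mulVec (x v))) (fun a b => norm3_sub_comm _ _)]
  set t : V → ℝ := fun v => √(1 - x (Sum.inl v) 0 ^ 2) with ht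
  have ht2 : ∀ v, t v ^ 2 = 1 - x (Sum.inl v) 0 ^ 2 := by
    intro v
    apply Real.sq_sqrt
    nlinarith [unit_sq (hx (Sum.inl v)), sq_nonneg (x (Sum.inl v) 1),
      sq_nonneg (x (Sum.inl v) 2)]
  set d : V → ℝ := fun u => ∑ v, if G.Adj u v then (1 : ℝ) else 0 with hd
  have hd0 : ∀ u, 0 ≤ d u := fun u => Finset.sum_nonneg fun v _ => by split_ifs <;> simp
  have hdsum : ∑ u, d u = 2 * (G.edgeFinset.card : ℝ) := by
    have := sum_adj G
    have h' : ((∑ u, ∑ v, if G.Adj u v then 1 else 0 : ℕ) : ℝ) = 2 * (G.edgeFinset.card : ℝ) := by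
      rw [this]; push_cast; ring
    rw [← h']; push_cast; rfl
  set y : V → Bool := fun v => decide (0 ≤ x (Sum.inl v) 0) with hy
  have hcut : (∑ u, ∑ v, if G.Adj u v ∧ y u ≠ y v then (1 : ℝ) else 0) ≤ 2 * maxCut G := by
    have := cut_le G y
    have h' : ((∑ u, ∑ v, if G.Adj u v ∧ y u ≠ y v then 1 else 0 : ℕ) : ℝ)
      ≤ ((2 * maxCut G : ℕ) : ℝ) := by exact_mod_cast this
    push_cast at h'
    exact h'
  have hE : (∑ u, ∑ v, if G.Adj u v then
      norm3 ((Matrix.diagonal ![1, β, γ]).mulVec (x (Sum.inl u))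
        - (Matrix.diagonal ![1, β, γ]).mulVec (x (Sum.inl v))) else 0)
      ≤ 2 * (∑ u, ∑ v, if G.Adj u v ∧ y u ≠ y v then (1 : ℝ) else 0) + 4 * ∑ u, d u * t u := by
    have e1 : ∑ u, d u * t u = ∑ u, ∑ v, if G.Adj u v then t u else 0 := by
      simp only [hd, Finset.sum_mul, ite_mul, one_mul, zero_mul]
    have e2 : ∑ u, d u * t u = ∑ u, ∑ v, if G.Adj u v then t v else 0 := by
      rw [e1, Finset.sum_comm]
      simp only [SimpleGraph.adj_comm]
    have e3 : 4 * ∑ u, d u * t u = 2 * (∑ u, ∑ v, if G.Adj u v then t u else 0)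
        + 2 * (∑ u, ∑ v, if G.Adj u v then t v else 0) := by
      rw [← e1, ← e2]; ring
    rw [e3]
    simp only [Finset.mul_sum, ← Finset.sum_add_distrib]
    refine Finset.sum_le_sum fun u _ => Finset.sum_le_sum fun v _ => ?_
    by_cases h : G.Adj u v
    · have := edge_le hβ hγβ hγ (hx (Sum.inl u)) (hx (Sum.inl v))
      simp only [h, if_true, true_and]
      by_cases hc : y u ≠ y v
      · rw [if_pos hc] at this ⊢
        simp only [ht]
        linarith
      · rw [if_neg hc] at this ⊢
        simp only [ht]
        linarith
    · simp [h]
  have hL : (∑ v, ∑ i, norm3 ((Matrix.diagonal ![1, β, γ]).mulVec (x (Sum.inl v))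
        - (Matrix.diagonal ![1, β, γ]).mulVec (x (Sum.inr (v, i)))))
      ≤ ∑ v, K * (2 - δ * t v ^ 2 / 2) := by
    refine Finset.sum_le_sum fun v _ => ?_
    calc _ ≤ ∑ i : Fin K, (2 - δ * t v ^ 2 / 2) := by
            refine Finset.sum_le_sum fun i _ => ?_
            rw [ht2]
            exact leaf_le hβ hγβ hγ (hx _) (hx _)
      _ = _ := by rw [Finset.sum_const, Finset.card_univ, Fintype.card_fin, nsmul_eq_mul]
  have hq : ∀ v, d v * t v + K * (2 - δ * t v ^ 2 / 2) / 2 ≤ K + d v ^ 2 / (K * δ) := by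
    intro v
    have hp : 0 < K * δ := mul_pos hKr hδ
    have : d v * t v - K * δ * t v ^ 2 / 4 ≤ d v ^ 2 / (K * δ) := by
      rw [le_div_iff₀ hp]
      nlinarith [sq_nonneg (d v - K * δ * t v / 2)]
    linarith
  have hqs := Finset.sum_le_sum fun v (_ : v ∈ Finset.univ) => hq v
  rw [Finset.sum_add_distrib, Finset.sum_add_distrib, ← Finset.sum_div, ← Finset.sum_div,
    Finset.sum_const, Finset.card_univ, nsmul_eq_mul] at hqs
  have hdd : ∑ v, d v ^ 2 ≤ 4 * (G.edgeFinset.card : ℝ) ^ 2 := by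
    have : ∑ v, d v ^ 2 ≤ (∑ v, d v) ^ 2 := by
      rw [sq (∑ v, d v), Finset.sum_mul]
      refine Finset.sum_le_sum fun v _ => ?_
      rw [sq]
      exact mul_le_mul_of_nonneg_left
        (Finset.single_le_sum (fun i _ => hd0 i) (Finset.mem_univ v)) (hd0 v)
    rw [hdsum] at this
    nlinarith
  have hdd' : (∑ v, d v ^ 2) / (K * δ) ≤ 4 * (G.edgeFinset.card : ℝ) ^ 2 / (K * δ) := by
    gcongr
  linarith

/-- For `W = diag(1,β,γ)` with `1 > β ≥ γ ≥ 0`, there exists `N` (depending only on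
`β`) such that for every graph `G` with `n ≥ N` vertices and `m ≥ 1` edges, with
`K = m³·n`: for every integer `C > 1`, if `WLMC_W(H) > C + K·n - 1/2` then `MC(G) ≥ C`,
where `H` attaches `K` leaves to every vertex of `G`. -/
theorem stmt15 (β γ : ℝ) (hβ : β < 1) (hγβ : γ ≤ β) (hγ : 0 ≤ γ) :
    ∃ N : ℕ, ∀ (V : Type) [Fintype V] [DecidableEq V] (G : SimpleGraph V)
      [DecidableRel G.Adj],
      N ≤ Fintype.card V → 1 ≤ G.edgeFinset.card →
      ∀ C : ℕ, 1 < C →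
      wlmc (Matrix.diagonal ![1, β, γ])
          (addLeaves G (G.edgeFinset.card ^ 3 * Fintype.card V)) >
        (C : ℝ) + ((G.edgeFinset.card ^ 3 * Fintype.card V : ℕ) : ℝ) *
          (Fintype.card V : ℝ) - 1 / 2 →
      maxCut G ≥ C := by
  have hδ : 0 < 1 - β ^ 2 := by nlinarith
  obtain ⟨N, hN⟩ := exists_nat_ge (8 / (1 - β ^ 2))
  refine ⟨N, ?_⟩
  intro V _ _ G _ hn hm C hC hw
  by_contra hlt
  have hlt : maxCut G + 1 ≤ C := by omega
  have hltr : (maxCut G : ℝ) + 1 ≤ C := by exact_mod_cast hlt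
  have hnr : 8 / (1 - β ^ 2) ≤ (Fintype.card V : ℝ) := hN.trans (by exact_mod_cast hn)
  have hn0 : (0 : ℝ) < Fintype.card V := lt_of_lt_of_le (by positivity) hnr
  have hn0' : 0 < Fintype.card V := by exact_mod_cast hn0
  have hmr : (1 : ℝ) ≤ G.edgeFinset.card := by exact_mod_cast hm
  set m := G.edgeFinset.card with hmd
  set n := Fintype.card V with hnd
  have hK : 0 < m ^ 3 * n := by positivity
  have herr : 4 * (m : ℝ) ^ 2 / (((m ^ 3 * n : ℕ) : ℝ) * (1 - β ^ 2)) ≤ 1 / 2 := by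
    push_cast
    rw [div_le_iff₀ (by positivity)]
    rw [div_le_iff₀ hδ] at hnr
    have h1 : (m : ℝ) ^ 2 * 8 ≤ (m : ℝ) ^ 2 * (n * (1 - β ^ 2)) := by gcongr
    have h2 : (m : ℝ) ^ 2 * (n * (1 - β ^ 2)) ≤ (m : ℝ) ^ 3 * (n * (1 - β ^ 2)) := by
      gcongr
      norm_num
    linarith
  have hCr : (1 : ℝ) < C := by exact_mod_cast hC
  refine absurd hw (not_lt.2 ?_)
  unfold wlmc
  apply Real.sSup_le
  · rintro c ⟨x, hx, rfl⟩
    have := value_le hβ hγβ hγ G (m ^ 3 * n) hK x hx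
    linarith
  · have : (0 : ℝ) ≤ ((m ^ 3 * n : ℕ) : ℝ) * (n : ℝ) := by positivity
    linarith
end
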